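/- There exists n₀ such that for all n ≥ n₀ the following holds: if A is a finite set of unit vectors in Euclidean space ℝⁿ such that ⟨u, v⟩ ≤ 1/2 for all distinct u, v ∈ A (i.e. the pairwise angles are at least π/3), then #A ≤ 2^{0.402·n}. -/

import Mathlib

open scoped RealInnerProductSpace

namespace KL
open MvPolynomial

/-- Homogenised Gegenbauer polynomials in dimension `N + 2`, normalised to be `1` at `(1,1)`. -/
noncomputable def Z (N : ℕ) {A : Type*} [CommRing A] [Algebra ℝ A] (t r : A) : ℕ → A
  | 0 => 1
  | 1 => t
  | k + 2 => algebraMap ℝ A ((2 * k + N + 2 : ℝ) / (k + N + 1)) * (t * Z N t r (k + 1))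
      - algebraMap ℝ A ((k + 1 : ℝ) / (k + N + 1)) * (r * Z N t r k)

lemma Z_rec (N : ℕ) {A : Type*} [CommRing A] [Algebra ℝ A] (t r : A) (k : ℕ) :
    (k + N + 1 : A) * Z N t r (k + 2) =
      (2 * k + N + 2) * (t * Z N t r (k + 1)) - (k + 1) * (r * Z N t r k) := by
  have h : (k + N + 1 : ℝ) ≠ 0 := by positivity
  have e : (k + N + 1 : A) = algebraMap ℝ A (k + N + 1) := by simp
  have e1 : (2 * k + N + 2 : A) = algebraMap ℝ A (2 * k + N + 2) := by
    simp only [map_add, map_mul, map_natCast, map_ofNat]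
  have e2 : (k + 1 : A) = algebraMap ℝ A (k + 1) := by simp
  rw [e, e1, e2, Z, mul_sub, ← mul_assoc, ← mul_assoc (algebraMap ℝ A (k + N + 1)), ← map_mul,
    ← map_mul, mul_div_cancel₀ _ h, mul_div_cancel₀ _ h]

lemma Z_map (N : ℕ) {A B : Type*} [CommRing A] [Algebra ℝ A] [CommRing B] [Algebra ℝ B]
    (f : A →ₐ[ℝ] B) (t r : A) (k : ℕ) : f (Z N t r k) = Z N (f t) (f r) k := by
  induction k using Nat.twoStepInduction with
  | zero => simp [Z]
  | one => simp [Z]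
  | more k h1 h2 => rw [Z, Z]; simp only [map_sub, map_mul, h1, h2, AlgHom.commutes]

lemma Z_one (N : ℕ) (k : ℕ) : Z N (1 : ℝ) 1 k = 1 := by
  induction k using Nat.twoStepInduction with
  | zero => simp [Z]
  | one => simp [Z]
  | more k h1 h2 =>
    rw [Z, h1, h2]
    have h : (k + N + 1 : ℝ) ≠ 0 := by positivity
    simp only [Algebra.algebraMap_self, RingHom.id_apply]
    field_simp
    ring

section
variable {n : ℕ}

noncomputable def ell (y : Fin n → ℝ) : MvPolynomial (Fin n) ℝ := ∑ i, C (y i) * X i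
noncomputable def RR (n : ℕ) : MvPolynomial (Fin n) ℝ := ∑ i, X i * X i
noncomputable def DD (y : Fin n → ℝ) (p : MvPolynomial (Fin n) ℝ) : MvPolynomial (Fin n) ℝ :=
  ∑ i, C (y i) * pderiv i p
noncomputable def Lap (p : MvPolynomial (Fin n) ℝ) : MvPolynomial (Fin n) ℝ :=
  ∑ i, pderiv i (pderiv i p)

lemma pderiv_ell (y : Fin n → ℝ) (i : Fin n) : pderiv i (ell y) = C (y i) := by
  simp only [ell, map_sum, pderiv_C_mul, pderiv_X]
  rw [Finset.sum_eq_single i] <;> simp +contextual [eq_comm]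

lemma pderiv_RR (i : Fin n) : pderiv i (RR n) = 2 * X i := by
  simp only [RR, map_sum, Derivation.leibniz, pderiv_X, smul_eq_mul]
  rw [Finset.sum_eq_single i]
  · simp; ring
  · intro b _ hb; simp [hb]
  · simp

lemma DD_mul (y : Fin n → ℝ) (p q : MvPolynomial (Fin n) ℝ) :
    DD y (p * q) = p * DD y q + q * DD y p := by
  simp only [DD, Derivation.leibniz, smul_eq_mul, Finset.mul_sum, ← Finset.sum_add_distrib]
  exact Finset.sum_congr rfl fun i _ => by ring

lemma DD_sub (y : Fin n → ℝ) (p q : MvPolynomial (Fin n) ℝ) :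
    DD y (p - q) = DD y p - DD y q := by
  simp only [DD, map_sub, mul_sub, Finset.sum_sub_distrib]

lemma DD_C (y : Fin n → ℝ) (a : ℝ) : DD y (C a) = 0 := by simp [DD]

lemma DD_ell (y : Fin n → ℝ) (hy : ∑ i, y i * y i = 1) : DD y (ell y) = 1 := by
  simp only [DD, pderiv_ell, ← C_mul, ← map_sum, hy, C_1]

lemma DD_RR (y : Fin n → ℝ) : DD y (RR n) = 2 * ell y := by
  simp only [DD, pderiv_RR, ell, Finset.mul_sum]
  exact Finset.sum_congr rfl fun i _ => by ring

lemma Lap_sub (p q : MvPolynomial (Fin n) ℝ) : Lap (p - q) = Lap p - Lap q := by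
  simp only [Lap, map_sub, Finset.sum_sub_distrib]

lemma Lap_C_mul (a : ℝ) (p : MvPolynomial (Fin n) ℝ) : Lap (C a * p) = C a * Lap p := by
  simp only [Lap, pderiv_C_mul, Finset.mul_sum]

lemma Lap_ell_mul (y : Fin n → ℝ) (p : MvPolynomial (Fin n) ℝ) :
    Lap (ell y * p) = 2 * DD y p + ell y * Lap p := by
  simp only [Lap, DD, Derivation.leibniz, map_add, smul_eq_mul, pderiv_ell, Finset.mul_sum,
    ← Finset.sum_add_distrib, pderiv_C]
  exact Finset.sum_congr rfl fun i _ => by ring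

lemma Lap_RR_mul (p : MvPolynomial (Fin n) ℝ) (k : ℕ) (hp : p.IsHomogeneous k) :
    Lap (RR n * p) = (2 * n + 4 * k) * p + RR n * Lap p := by
  have h := hp.sum_X_mul_pderiv
  rw [nsmul_eq_mul] at h
  have : ∀ i : Fin n, pderiv i (pderiv i (RR n * p)) =
      2 * p + 4 * (X i * pderiv i p) + RR n * pderiv i (pderiv i p) := by
    intro i
    have h2 : pderiv i (2 : MvPolynomial (Fin n) ℝ) = 0 := by
      have : (2 : MvPolynomial (Fin n) ℝ) = C 2 := (map_ofNat C 2).symm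
      rw [this, pderiv_C]
    simp only [Derivation.leibniz, map_add, smul_eq_mul, pderiv_RR, pderiv_X_self, h2]
    ring
  simp only [Lap, this, Finset.sum_add_distrib, ← Finset.mul_sum, h, Finset.sum_const,
    Finset.card_univ, Fintype.card_fin, nsmul_eq_mul]
  ring

end

section
variable {N : ℕ}

noncomputable abbrev ZZ (N : ℕ) (y : Fin (N + 2) → ℝ) (k : ℕ) : MvPolynomial (Fin (N + 2)) ℝ :=
  Z N (ell y) (RR (N + 2)) k

lemma ell_hom (y : Fin (N + 2) → ℝ) : (ell y).IsHomogeneous 1 :=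
  IsHomogeneous.sum _ _ _ fun i _ => by
    simpa using (isHomogeneous_C (Fin (N + 2)) (y i)).mul (isHomogeneous_X ℝ i)

lemma RR_hom (n : ℕ) : (RR n).IsHomogeneous 2 :=
  IsHomogeneous.sum _ _ _ fun i _ => (isHomogeneous_X ℝ i).mul (isHomogeneous_X ℝ i)

lemma ZZ_hom (y : Fin (N + 2) → ℝ) (k : ℕ) : (ZZ N y k).IsHomogeneous k := by
  induction k using Nat.twoStepInduction with
  | zero => exact isHomogeneous_one _ _
  | one => exact ell_hom y
  | more k h1 h2 =>
    rw [ZZ, Z]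
    refine IsHomogeneous.sub ?_ ?_
    · have := (isHomogeneous_C (Fin (N + 2)) ((2 * k + N + 2 : ℝ) / (k + N + 1))).mul
        ((ell_hom y).mul h2)
      rw [show k + 2 = 0 + (1 + (k + 1)) by omega]
      exact this
    · have := (isHomogeneous_C (Fin (N + 2)) ((k + 1 : ℝ) / (k + N + 1))).mul
        ((RR_hom _).mul h1)
      rw [show k + 2 = 0 + (2 + k) by omega]
      exact this

lemma cast_ne (N k : ℕ) : ((k + N + 1 : ℕ) : MvPolynomial (Fin (N + 2)) ℝ) ≠ 0 :=
  Nat.cast_ne_zero.2 (by omega)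

lemma DD_nat_mul (y : Fin (N + 2) → ℝ) (m : ℕ) (p : MvPolynomial (Fin (N + 2)) ℝ) :
    DD y ((m : MvPolynomial (Fin (N + 2)) ℝ) * p) =
      (m : MvPolynomial (Fin (N + 2)) ℝ) * DD y p := by
  have : (m : MvPolynomial (Fin (N + 2)) ℝ) = C (m : ℝ) := by simp
  rw [this, DD_mul, DD_C]; ring

lemma Lap_nat_mul (m : ℕ) (p : MvPolynomial (Fin (N + 2)) ℝ) :
    Lap ((m : MvPolynomial (Fin (N + 2)) ℝ) * p) =
      (m : MvPolynomial (Fin (N + 2)) ℝ) * Lap p := by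
  have : (m : MvPolynomial (Fin (N + 2)) ℝ) = C (m : ℝ) := by simp
  rw [this, Lap_C_mul]

lemma ZZ_rec (y : Fin (N + 2) → ℝ) (k : ℕ) :
    ((k + N + 1 : ℕ) : MvPolynomial (Fin (N + 2)) ℝ) * ZZ N y (k + 2) =
      ((2 * k + N + 2 : ℕ) : MvPolynomial (Fin (N + 2)) ℝ) * (ell y * ZZ N y (k + 1))
      - ((k + 1 : ℕ) : MvPolynomial (Fin (N + 2)) ℝ) * (RR (N + 2) * ZZ N y k) := by
  have := Z_rec N (ell y) (RR (N + 2)) k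
  push_cast
  exact this

lemma DD_ZZ (y : Fin (N + 2) → ℝ) (hy : ∑ i, y i * y i = 1) (k : ℕ) :
    DD y (ZZ N y (k + 1)) = ((k + 1 : ℕ) : MvPolynomial (Fin (N + 2)) ℝ) * ZZ N y k := by
  induction k using Nat.twoStepInduction with
  | zero => simp [ZZ, Z, DD_ell y hy]
  | one =>
    apply mul_left_cancel₀ (cast_ne N 0)
    have h0 : DD y (ZZ N y 0) = 0 := by
      have : ZZ N y 0 = C 1 := by simp [ZZ, Z]
      rw [this, DD_C]
    have h1 : DD y (ZZ N y 1) = 1 := DD_ell y hy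
    rw [← DD_nat_mul, ZZ_rec, DD_sub, DD_nat_mul, DD_nat_mul, DD_mul, DD_mul, h1, DD_ell y hy,
      DD_RR, h0]
    simp only [ZZ, Z]
    push_cast
    ring
  | more k h1 h2 =>
    apply mul_left_cancel₀ (cast_ne N (k + 1))
    rw [← DD_nat_mul, ZZ_rec, DD_sub, DD_nat_mul, DD_nat_mul, DD_mul, DD_mul, h1, h2, DD_ell y hy,
      DD_RR]
    have h3 := ZZ_rec y k
    push_cast at h3 ⊢
    linear_combination (-(k : MvPolynomial (Fin (N + 2)) ℝ) - 2) * h3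

lemma Lap_ZZ (y : Fin (N + 2) → ℝ) (hy : ∑ i, y i * y i = 1) (k : ℕ) :
    Lap (ZZ N y k) = 0 := by
  induction k using Nat.twoStepInduction with
  | zero => simp [ZZ, Z, Lap]
  | one => simp [ZZ, Z, Lap, pderiv_ell]
  | more k h1 h2 =>
    apply mul_left_cancel₀ (cast_ne N k)
    rw [← Lap_nat_mul, ZZ_rec, Lap_sub, Lap_nat_mul, Lap_nat_mul, Lap_ell_mul,
      Lap_RR_mul _ k (ZZ_hom y k), h1, h2, DD_ZZ y hy]
    push_cast
    ring

lemma ZZ_lead (N k : ℕ) :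
    ∃ c : ℝ, 0 < c ∧ ∀ y : Fin (N + 2) → ℝ, ∃ S, ZZ N y k = C c * ell y ^ k + RR (N + 2) * S ∧
      (k < 2 → S = 0) := by
  induction k using Nat.twoStepInduction with
  | zero => exact ⟨1, one_pos, fun y => ⟨0, by simp [ZZ, Z], by simp⟩⟩
  | one => exact ⟨1, one_pos, fun y => ⟨0, by simp [ZZ, Z], by simp⟩⟩
  | more k h1 h2 =>
    obtain ⟨c, hc, h2⟩ := h2
    refine ⟨(2 * k + N + 2 : ℝ) / (k + N + 1) * c, by positivity, fun y => ?_⟩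
    obtain ⟨S, hS, -⟩ := h2 y
    refine ⟨C ((2 * k + N + 2 : ℝ) / (k + N + 1)) * ell y * S
      - C ((k + 1 : ℝ) / (k + N + 1)) * ZZ N y k, ?_, by omega⟩
    rw [ZZ, Z]
    change C _ * (ell y * ZZ N y (k+1)) - C _ * (RR _ * ZZ N y k) = _
    rw [hS, C_mul]
    ring

/-- Multi-indices of degree `k`. -/
noncomputable def II (n k : ℕ) : Finset (Fin n →₀ ℕ) := Finset.finsuppAntidiag Finset.univ k

lemma mem_II {n k : ℕ} {a : Fin n →₀ ℕ} : a ∈ II n k ↔ ∑ i, a i = k := by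
  simp [II]

lemma card_II (n k : ℕ) : (II n k).card = (n + k - 1).choose k := by
  simp [II, Finset.card_finsuppAntidiag_nat_eq_choose]

noncomputable def ww {n : ℕ} (a : Fin n →₀ ℕ) : ℝ := ∏ i, ((a i).factorial : ℝ)

lemma ww_pos {n : ℕ} (a : Fin n →₀ ℕ) : 0 < ww a :=
  Finset.prod_pos fun i _ => by positivity

lemma ww_add {n : ℕ} (a : Fin n →₀ ℕ) (i : Fin n) :
    ww (a + Finsupp.single i 1) = (a i + 1) * ww a := by
  unfold ww
  rw [← Finset.mul_prod_erase _ _ (Finset.mem_univ i),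
    ← Finset.mul_prod_erase _ (fun j => ((a j).factorial : ℝ)) (Finset.mem_univ i), ← mul_assoc]
  congr 1
  · simp [Nat.factorial_succ]
  · refine Finset.prod_congr rfl fun j hj => ?_
    have : i ≠ j := (Finset.ne_of_mem_erase hj).symm
    simp [this]

/-- Fischer inner product in degree `k`. -/
noncomputable def BB {n : ℕ} (k : ℕ) (p q : MvPolynomial (Fin n) ℝ) : ℝ :=
  ∑ a ∈ II n k, ww a * coeff a p * coeff a q

variable {n : ℕ}

lemma BB_add (k : ℕ) (p p' q : MvPolynomial (Fin n) ℝ) :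
    BB k (p + p') q = BB k p q + BB k p' q := by
  simp only [BB, coeff_add, ← Finset.sum_add_distrib]
  exact Finset.sum_congr rfl fun i _ => by ring

lemma BB_zero_right (k : ℕ) (p : MvPolynomial (Fin n) ℝ) : BB k p 0 = 0 := by
  simp [BB]

lemma BB_zero_left (k : ℕ) (p : MvPolynomial (Fin n) ℝ) : BB k 0 p = 0 := by
  simp [BB]

lemma BB_sum {ι : Type*} (s : Finset ι) (k : ℕ) (f : ι → MvPolynomial (Fin n) ℝ)
    (q : MvPolynomial (Fin n) ℝ) : BB k (∑ i ∈ s, f i) q = ∑ i ∈ s, BB k (f i) q := by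
  classical
  induction s using Finset.induction_on with
  | empty => simp [BB_zero_left]
  | insert a s h ih => rw [Finset.sum_insert h, Finset.sum_insert h, BB_add, ih]

lemma BB_sum_right {ι : Type*} (s : Finset ι) (k : ℕ) (f : ι → MvPolynomial (Fin n) ℝ)
    (q : MvPolynomial (Fin n) ℝ) : BB k q (∑ i ∈ s, f i) = ∑ i ∈ s, BB k q (f i) := by
  simp only [BB, coeff_sum, Finset.mul_sum]
  exact Finset.sum_comm

lemma BB_C_mul (k : ℕ) (c : ℝ) (p q : MvPolynomial (Fin n) ℝ) :
    BB k (C c * p) q = c * BB k p q := by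
  simp only [BB, coeff_C_mul, Finset.mul_sum]
  exact Finset.sum_congr rfl fun i _ => by ring

lemma BB_X_mul (k : ℕ) (i : Fin n) (p q : MvPolynomial (Fin n) ℝ) :
    BB (k + 1) (X i * p) q = BB k p (pderiv i q) := by
  classical
  unfold BB
  symm
  refine Finset.sum_of_injOn (fun a => a + Finsupp.single i 1) ?_ ?_ ?_ ?_
  · intro a _ b _ h
    exact add_right_cancel h
  · intro a ha
    have ha := mem_II.1 ha
    refine mem_II.2 ?_
    simp [Finset.sum_add_distrib, ha, Finsupp.single_apply]
  · intro a ha hna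
    rw [coeff_X_mul', if_neg]
    · ring
    intro hi
    apply hna
    have hle : Finsupp.single i 1 ≤ a := by
      rw [Finsupp.single_le_iff]
      exact Nat.one_le_iff_ne_zero.2 (Finsupp.mem_support_iff.1 hi)
    refine ⟨a - Finsupp.single i 1, ?_, tsub_add_cancel_of_le hle⟩
    have ha := mem_II.1 ha
    refine mem_II.2 ?_
    have : ∑ j, (a - Finsupp.single i 1 + Finsupp.single i 1 : Fin n →₀ ℕ) j = k + 1 := by
      rw [tsub_add_cancel_of_le hle, ha]
    simp only [Finsupp.add_apply, Finset.sum_add_distrib] at this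
    simpa [Finsupp.single_apply] using this
  · intro a _
    rw [coeff_pderiv, ww_add]
    have : coeff (a + Finsupp.single i 1) (X i * p) = coeff a p := by
      rw [add_comm, coeff_X_mul]
    rw [this]
    ring

lemma BB_RR_mul (k : ℕ) (p q : MvPolynomial (Fin n) ℝ) :
    BB (k + 2) (RR n * p) q = BB k p (Lap q) := by
  rw [RR, Finset.sum_mul, BB_sum, Lap, BB_sum_right]
  refine Finset.sum_congr rfl fun i _ => ?_
  rw [mul_assoc, BB_X_mul, BB_X_mul]

lemma BB_ell_pow (y : Fin n → ℝ) (k : ℕ) (q : MvPolynomial (Fin n) ℝ) (hq : q.IsHomogeneous k) :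
    BB k (ell y ^ k) q = k.factorial * aeval y q := by
  induction k generalizing q with
  | zero =>
    have h0 : II n 0 = {0} := by
      ext a; rw [mem_II]; simp [Finsupp.ext_iff]
    rw [BB, h0]
    have h := totalDegree_eq_zero_iff_eq_C.1 (Nat.le_zero.1 hq.totalDegree_le)
    rw [h]
    simp [ww]
  | succ k ih =>
    rw [pow_succ', ell, Finset.sum_mul, BB_sum]
    have h : ∀ i, BB (k + 1) (C (y i) * X i * ell y ^ k) q
        = k.factorial * aeval y (X i * pderiv i q) := by
      intro i
      rw [mul_assoc, BB_C_mul, BB_X_mul, ih _ (by simpa using hq.pderiv), map_mul, aeval_X]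
      ring
    have e := congrArg (aeval y) hq.sum_X_mul_pderiv
    rw [map_sum, nsmul_eq_mul, map_mul, map_natCast] at e
    rw [ell] at h
    rw [Finset.sum_congr rfl fun i _ => h i, ← Finset.mul_sum, e, Nat.factorial_succ]
    push_cast
    ring

lemma aeval_ZZ (y z : Fin (N + 2) → ℝ) (hy : ∑ i, y i * y i = 1) (k : ℕ) :
    aeval y (ZZ N z k) = Z N (∑ i, y i * z i) 1 k := by
  rw [ZZ, Z_map]
  congr 1
  · simp [ell, mul_comm]
  · simp [RR, hy]

lemma BB_ZZ (N k : ℕ) : ∃ c : ℝ, 0 < c ∧ ∀ y z : Fin (N + 2) → ℝ, ∑ i, y i * y i = 1 →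
    ∑ i, z i * z i = 1 → BB k (ZZ N y k) (ZZ N z k) = c * Z N (∑ i, y i * z i) 1 k := by
  obtain ⟨c, hc, h⟩ := ZZ_lead N k
  refine ⟨c * k.factorial, by positivity, fun y z hy hz => ?_⟩
  obtain ⟨S, hS, hS0⟩ := h y
  rw [hS, BB_add, BB_C_mul, BB_ell_pow _ _ _ (ZZ_hom z k), aeval_ZZ _ _ hy]
  have : BB k (RR (N + 2) * S) (ZZ N z k) = 0 := by
    by_cases hk : k < 2
    · rw [hS0 hk, mul_zero, BB_zero_left]
    · obtain ⟨m, rfl⟩ := Nat.exists_eq_add_of_le (not_lt.1 hk)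
      rw [add_comm 2 m, BB_RR_mul, Lap_ZZ z hz, BB_zero_right]
  rw [this]
  ring

/-- Feature maps for the Gegenbauer kernels. -/
lemma features (N k : ℕ) : ∃ φ : (Fin (N + 2) →₀ ℕ) → (Fin (N + 2) → ℝ) → ℝ,
    ∀ y z : Fin (N + 2) → ℝ, ∑ i, y i * y i = 1 → ∑ i, z i * z i = 1 →
      Z N (∑ i, y i * z i) 1 k = ∑ a ∈ II (N + 2) k, φ a y * φ a z := by
  obtain ⟨c, hc, h⟩ := BB_ZZ N k
  refine ⟨fun a y => √(ww a / c) * coeff a (ZZ N y k), fun y z hy hz => ?_⟩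
  have h1 := h y z hy hz
  have h2 : Z N (∑ i, y i * z i) 1 k = BB k (ZZ N y k) (ZZ N z k) / c := by
    rw [h1]; field_simp
  rw [h2, BB, Finset.sum_div]
  refine Finset.sum_congr rfl fun a _ => ?_
  have : √(ww a / c) * √(ww a / c) = ww a / c :=
    Real.mul_self_sqrt (div_nonneg (ww_pos a).le hc.le)
  linear_combination (-(coeff a (ZZ N y k) * coeff a (ZZ N z k))) * this

end

section
open Finset

lemma sum4 {U V ι κ : Type*} (A : Finset U) (B : Finset V) (I : Finset ι) (J : Finset κ)
    (f : U → V → ι → κ → ℝ) :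
    ∑ u ∈ A, ∑ v ∈ B, ∑ a ∈ I, ∑ b ∈ J, f u v a b =
      ∑ a ∈ I, ∑ b ∈ J, ∑ u ∈ A, ∑ v ∈ B, f u v a b := by
  calc _ = ∑ u ∈ A, ∑ a ∈ I, ∑ v ∈ B, ∑ b ∈ J, f u v a b :=
        sum_congr rfl fun u _ => sum_comm
    _ = ∑ a ∈ I, ∑ u ∈ A, ∑ v ∈ B, ∑ b ∈ J, f u v a b := sum_comm
    _ = ∑ a ∈ I, ∑ u ∈ A, ∑ b ∈ J, ∑ v ∈ B, f u v a b :=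
        sum_congr rfl fun a _ => sum_congr rfl fun u _ => sum_comm
    _ = _ := sum_congr rfl fun a _ => sum_comm

lemma prod_kernel {V ι κ : Type*} (A : Finset V) (I : Finset ι) (J : Finset κ)
    (φ : ι → V → ℝ) (ψ : κ → V → ℝ) :
    ∑ u ∈ A, ∑ v ∈ A, (∑ a ∈ I, φ a u * φ a v) * (∑ b ∈ J, ψ b u * ψ b v)
      = ∑ a ∈ I, ∑ b ∈ J, (∑ u ∈ A, φ a u * ψ b u) ^ 2 := by
  have h : ∀ a b, (∑ u ∈ A, φ a u * ψ b u) ^ 2 =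
      ∑ u ∈ A, ∑ v ∈ A, (φ a u * φ a v) * (ψ b u * ψ b v) := by
    intro a b
    rw [sq, sum_mul_sum]
    exact sum_congr rfl fun u _ => sum_congr rfl fun v _ => by ring
  simp only [h, sum_mul_sum]
  exact sum4 _ _ _ _ _

lemma diag_kernel {V ι : Type*} (A : Finset V) (I : Finset ι) (φ : ι → V → ℝ)
    (h1 : ∀ u ∈ A, ∑ a ∈ I, φ a u * φ a u = 1) :
    (#A : ℝ) ^ 2 ≤ #I *
      ∑ u ∈ A, ∑ v ∈ A, (∑ a ∈ I, φ a u * φ a v) * (∑ b ∈ I, φ b u * φ b v) := by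
  rw [prod_kernel]
  have e : (#A : ℝ) = ∑ a ∈ I, ∑ u ∈ A, φ a u * φ a u := by
    rw [sum_comm, sum_congr rfl h1]; simp
  rw [e]
  refine sq_sum_le_card_mul_sum_sq.trans ?_
  gcongr with a ha
  exact single_le_sum (f := fun b => (∑ u ∈ A, φ a u * φ b u) ^ 2) (fun _ _ => sq_nonneg _) ha

noncomputable def pp (N i : ℕ) : ℝ := (i + N) / (2 * i + N)
noncomputable def qq (N i : ℕ) : ℝ := i / (2 * i + N)

lemma Z_shift (N : ℕ) (t : ℝ) (k : ℕ) :
    t * Z N t 1 (k + 1) = pp N (k + 1) * Z N t 1 (k + 2) + qq N (k + 1) * Z N t 1 k := by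
  have h := Z_rec N t 1 k
  have h0 : (2 * (k + 1) + N : ℝ) ≠ 0 := by positivity
  unfold pp qq
  push_cast
  field_simp
  linear_combination -h

noncomputable def gg (N m : ℕ) (c : ℕ → ℝ) (j : ℕ) : ℝ :=
  (if j = 0 then 0 else c (j - 1) * pp N (m + (j - 1))) + c (j + 1) * qq N (m + (j + 1)) - c j / 2

lemma gg_expand (N m M : ℕ) (c : ℕ → ℝ) (c0 : c 0 = 0) (cM : c M = 0) (cM1 : c (M + 1) = 0)
    (t : ℝ) : (t - 1 / 2) * ∑ j ∈ range (M + 1), c j * Z N t 1 (m + j) =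
      ∑ j ∈ range (M + 1), gg N m c j * Z N t 1 (m + j) := by
  have e1 : ∀ j, t * (c j * Z N t 1 (m + j)) = c j * pp N (m + j) * Z N t 1 (m + (j + 1)) +
      c j * qq N (m + j) * Z N t 1 (m + j - 1) := by
    intro j
    rcases j with _ | j
    · simp [c0]
    · have := Z_shift N t (m + j)
      rw [show m + (j + 1) = m + j + 1 by ring, show m + (j + 1 + 1) = m + j + 2 by ring,
        show m + j + 1 - 1 = m + j by omega]
      linear_combination c (j + 1) * this
  have e2 : ∑ j ∈ range (M + 1), c j * pp N (m + j) * Z N t 1 (m + (j + 1)) =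
      ∑ j ∈ range (M + 1), (if j = 0 then 0 else c (j - 1) * pp N (m + (j - 1))) *
        Z N t 1 (m + j) := by
    rw [sum_range_succ, cM, sum_range_succ' (fun j => (if j = 0 then 0 else
      c (j - 1) * pp N (m + (j - 1))) * Z N t 1 (m + j))]
    simp
  have e3 : ∑ j ∈ range (M + 1), c j * qq N (m + j) * Z N t 1 (m + j - 1) =
      ∑ j ∈ range (M + 1), c (j + 1) * qq N (m + (j + 1)) * Z N t 1 (m + j) := by
    have : ∑ j ∈ range (M + 1), c j * qq N (m + j) * Z N t 1 (m + j - 1) =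
        ∑ j ∈ range (M + 1 + 1), c j * qq N (m + j) * Z N t 1 (m + j - 1) := by
      rw [sum_range_succ _ (M + 1), cM1]; simp
    rw [this, sum_range_succ']
    simp [c0]
  rw [sub_mul, mul_sum, sum_congr rfl fun j _ => e1 j, sum_add_distrib, e2, e3, mul_sum,
    ← sum_add_distrib, ← sum_sub_distrib]
  refine sum_congr rfl fun j _ => ?_
  unfold gg
  ring

lemma LP (N m M : ℕ) (A : Finset (EuclideanSpace ℝ (Fin (N + 2)))) (hA : ∀ u ∈ A, ‖u‖ = 1)
    (hs : ∀ u ∈ A, ∀ v ∈ A, u ≠ v → ⟪u, v⟫ ≤ 1 / 2)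
    (c : ℕ → ℝ) (c0 : c 0 = 0) (cM : c M = 0) (cM1 : c (M + 1) = 0) (hc : ∀ j, 0 ≤ c j)
    (hM : 1 ≤ M) (hg : ∀ j < M + 1, 0 ≤ gg N m c j) (δ : ℝ) (hδ : 0 < δ)
    (hd : δ ≤ gg N m c 1 * c 1) :
    (#A : ℝ) ≤ (∑ j ∈ range (M + 1), c j) ^ 2 / (2 * δ) * ((N + 2 + m).choose (m + 1) : ℕ) := by
  have ip : ∀ u v : EuclideanSpace ℝ (Fin (N + 2)), ⟪u, v⟫ = ∑ i, u i * v i := by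
    intro u v
    simp [PiLp.inner_apply, mul_comm]
  have unit : ∀ u ∈ A, ∑ i, u i * u i = 1 := by
    intro u hu
    rw [← ip, real_inner_self_eq_norm_sq, hA u hu]; norm_num
  choose φ hφ using fun k => features N k
  have hφ' : ∀ k, ∀ u ∈ A, ∀ v ∈ A, Z N ⟪u, v⟫ 1 k = ∑ a ∈ II (N + 2) k, φ k a u * φ k a v := by
    intro k u hu v hv
    rw [ip, hφ k _ _ (unit u hu) (unit v hv)]
  have T0 : ∀ i j, 0 ≤ ∑ u ∈ A, ∑ v ∈ A, Z N ⟪u, v⟫ 1 i * Z N ⟪u, v⟫ 1 j := by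
    intro i j
    rw [sum_congr rfl fun u hu => sum_congr rfl fun v hv => by
      rw [hφ' i u hu v hv, hφ' j u hu v hv]]
    rw [prod_kernel A _ _ (fun a (u : EuclideanSpace ℝ (Fin (N + 2))) => φ i a u)
      (fun a (u : EuclideanSpace ℝ (Fin (N + 2))) => φ j a u)]
    positivity
  have T1 : ∀ i, (#A : ℝ) ^ 2 ≤ #(II (N + 2) i) *
      ∑ u ∈ A, ∑ v ∈ A, Z N ⟪u, v⟫ 1 i * Z N ⟪u, v⟫ 1 i := by
    intro i
    rw [sum_congr rfl fun u hu => sum_congr rfl fun v hv => by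
      rw [hφ' i u hu v hv]]
    refine diag_kernel A _ (fun a (u : EuclideanSpace ℝ (Fin (N + 2))) => φ i a u) ?_
    intro u hu
    rw [← hφ' i u hu u hu, real_inner_self_eq_norm_sq, hA u hu, one_pow, Z_one]
  set F : ℝ → ℝ := fun t => ∑ j ∈ range (M + 1), c j * Z N t 1 (m + j) with hF
  have F1 : F 1 = ∑ j ∈ range (M + 1), c j := by simp [hF, Z_one]
  have up : ∑ u ∈ A, ∑ v ∈ A, (⟪u, v⟫ - 1 / 2) * F ⟪u, v⟫ * F ⟪u, v⟫ ≤ #A * (F 1 ^ 2 / 2) := by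
    classical
    rw [← nsmul_eq_mul]
    refine sum_le_card_nsmul _ _ _ fun u hu => ?_
    calc _ ≤ ∑ v ∈ A, if u = v then F 1 ^ 2 / 2 else 0 := by
          refine sum_le_sum fun v hv => ?_
          split_ifs with h
          · rw [← h, real_inner_self_eq_norm_sq, hA u hu, one_pow]
            apply le_of_eq; ring
          · have := hs u hu v hv h
            rw [mul_assoc]
            exact mul_nonpos_of_nonpos_of_nonneg (by linarith) (mul_self_nonneg _)
      _ = _ := by simp [hu]
  have low : gg N m c 1 * c 1 * (∑ u ∈ A, ∑ v ∈ A, Z N ⟪u, v⟫ 1 (m + 1) * Z N ⟪u, v⟫ 1 (m + 1)) ≤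
      ∑ u ∈ A, ∑ v ∈ A, (⟪u, v⟫ - 1 / 2) * F ⟪u, v⟫ * F ⟪u, v⟫ := by
    have e : ∑ u ∈ A, ∑ v ∈ A, (⟪u, v⟫ - 1 / 2) * F ⟪u, v⟫ * F ⟪u, v⟫ =
        ∑ j ∈ range (M + 1), ∑ i ∈ range (M + 1), gg N m c j * c i *
          ∑ u ∈ A, ∑ v ∈ A, Z N ⟪u, v⟫ 1 (m + j) * Z N ⟪u, v⟫ 1 (m + i) := by
      simp only [mul_sum]
      rw [← sum4]
      refine sum_congr rfl fun u _ => sum_congr rfl fun v _ => ?_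
      rw [hF]
      dsimp only
      rw [gg_expand N m M c c0 cM cM1, sum_mul_sum]
      exact sum_congr rfl fun i _ => sum_congr rfl fun j _ => by ring
    rw [e]
    have m1 : 1 ∈ range (M + 1) := by simp; omega
    have nn : ∀ j ∈ range (M + 1), ∀ i, 0 ≤ gg N m c j * c i *
          ∑ u ∈ A, ∑ v ∈ A, Z N ⟪u, v⟫ 1 (m + j) * Z N ⟪u, v⟫ 1 (m + i) := fun j hj i =>
      mul_nonneg (mul_nonneg (hg j (mem_range.1 hj)) (hc i)) (T0 _ _)
    refine le_trans ?_ (single_le_sum (f := fun j => ∑ i ∈ range (M + 1), gg N m c j * c i *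
          ∑ u ∈ A, ∑ v ∈ A, Z N ⟪u, v⟫ 1 (m + j) * Z N ⟪u, v⟫ 1 (m + i))
          (fun j hj => sum_nonneg fun i _ => nn j hj i) m1)
    exact single_le_sum (f := fun i => gg N m c 1 * c i *
          ∑ u ∈ A, ∑ v ∈ A, Z N ⟪u, v⟫ 1 (m + 1) * Z N ⟪u, v⟫ 1 (m + i))
          (fun i _ => nn 1 m1 i) m1
  have hT := T1 (m + 1)
  rw [card_II, show N + 2 + (m + 1) - 1 = N + 2 + m by omega] at hT
  set T := ∑ u ∈ A, ∑ v ∈ A, Z N ⟪u, v⟫ 1 (m + 1) * Z N ⟪u, v⟫ 1 (m + 1) with hTdef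
  have hT0 : 0 ≤ T := T0 _ _
  rcases A.eq_empty_or_nonempty with rfl | hne
  · simp; positivity
  have hpos : (0 : ℝ) < #A := by exact_mod_cast hne.card_pos
  rw [F1] at up
  set D : ℝ := (((N + 2 + m).choose (m + 1) : ℕ) : ℝ)
  have hD : 0 ≤ D := Nat.cast_nonneg _
  set S := ∑ j ∈ range (M + 1), c j
  have h1 : δ * T ≤ #A * (S ^ 2 / 2) :=
    (mul_le_mul_of_nonneg_right hd hT0).trans (low.trans up)
  have h2 : #A * (#A : ℝ) ≤ #A * (S ^ 2 / (2 * δ) * D) := by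
    calc #A * (#A : ℝ) = (#A : ℝ) ^ 2 := by ring
      _ ≤ D * T := hT
      _ = D * (δ * T) / δ := by field_simp
      _ ≤ D * (#A * (S ^ 2 / 2)) / δ := by gcongr
      _ = _ := by field_simp
  exact le_of_mul_le_mul_left h2 hpos

end

set_option exponentiation.threshold 3000 in
lemma choose_bound (n k : ℕ) (hk : (k : ℝ) ≤ 12 / 155 * n) :
    ((n + k).choose k : ℝ) ≤ (2 : ℝ) ^ ((623 / 1550 : ℝ) * n) := by
  have h1 : ((n + k).choose k : ℝ) * (12 / 155) ^ k ≤ (167 / 155 : ℝ) ^ (n + k) := by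
    have := add_pow (12 / 155 : ℝ) 1 (n + k)
    rw [show (12 / 155 + 1 : ℝ) = 167 / 155 by norm_num] at this
    rw [this]
    have h := Finset.single_le_sum (s := Finset.range (n + k + 1))
      (f := fun m => (12 / 155 : ℝ) ^ m * 1 ^ (n + k - m) * ((n + k).choose m : ℝ))
      (fun i _ => by positivity) (Finset.mem_range.2 (show k < n + k + 1 by omega))
    refine le_trans (le_of_eq ?_) h
    simp [mul_comm]
  have h2 : ((n + k).choose k : ℝ) ≤ (167 / 155 : ℝ) ^ n * (167 / 12) ^ k := by
    have e : (167 / 155 : ℝ) ^ (n + k) = (167 / 155 : ℝ) ^ n * (167 / 12) ^ k * (12 / 155) ^ k := by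
      rw [mul_assoc, ← mul_pow, pow_add]; norm_num
    rw [e] at h1
    exact le_of_mul_le_mul_right h1 (by positivity)
  have h3 : (167 / 12 : ℝ) ^ k ≤ (167 / 12 : ℝ) ^ ((12 / 155 : ℝ) * n) := by
    rw [← Real.rpow_natCast]
    exact Real.rpow_le_rpow_of_exponent_le (by norm_num) hk
  have h4 : (167 / 155 : ℝ) * (167 / 12 : ℝ) ^ (12 / 155 : ℝ) ≤ (2 : ℝ) ^ (623 / 1550 : ℝ) := by
    rw [← pow_le_pow_iff_left₀ (by positivity) (by positivity) (show 1550 ≠ 0 by norm_num),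
      mul_pow, ← Real.rpow_natCast ((167 / 12 : ℝ) ^ (12 / 155 : ℝ)),
      ← Real.rpow_natCast ((2 : ℝ) ^ (623 / 1550 : ℝ)),
      ← Real.rpow_mul (by norm_num), ← Real.rpow_mul (by norm_num)]
    rw [show (12 / 155 : ℝ) * (1550 : ℕ) = (120 : ℕ) by norm_num,
      show (623 / 1550 : ℝ) * (1550 : ℕ) = (623 : ℕ) by norm_num, Real.rpow_natCast,
      Real.rpow_natCast, div_pow, div_pow, div_mul_div_comm, div_le_iff₀ (by positivity)]
    norm_num
  calc ((n + k).choose k : ℝ) ≤ (167 / 155 : ℝ) ^ n * (167 / 12) ^ k := h2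
    _ ≤ (167 / 155 : ℝ) ^ n * (167 / 12 : ℝ) ^ ((12 / 155 : ℝ) * n) := by gcongr
    _ = ((167 / 155 : ℝ) * (167 / 12 : ℝ) ^ (12 / 155 : ℝ)) ^ n := by
      rw [mul_pow, Real.rpow_mul (by norm_num), Real.rpow_natCast]
    _ ≤ ((2 : ℝ) ^ (623 / 1550 : ℝ)) ^ n := by gcongr
    _ = _ := by rw [Real.rpow_mul (by norm_num), Real.rpow_natCast]

lemma K_bound (K : ℝ) : ∃ n₁ : ℕ, ∀ n : ℕ, n₁ ≤ n →
    K * (2 : ℝ) ^ ((623 / 1550 : ℝ) * n) ≤ (2 : ℝ) ^ ((0.402 : ℝ) * n) := by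
  have h1 : 1 < (2 : ℝ) ^ (0.402 - 623 / 1550 : ℝ) :=
    Real.one_lt_rpow (by norm_num) (by norm_num)
  have h := (tendsto_pow_atTop_atTop_of_one_lt h1).eventually_ge_atTop K
  obtain ⟨n₁, h⟩ := Filter.eventually_atTop.1 h
  refine ⟨n₁, fun n hn => ?_⟩
  have := h n hn
  rw [← Real.rpow_natCast, ← Real.rpow_mul (by norm_num)] at this
  calc _ ≤ (2 : ℝ) ^ ((0.402 - 623 / 1550 : ℝ) * n) * (2 : ℝ) ^ ((623 / 1550 : ℝ) * n) := by gcongr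
    _ = _ := by rw [← Real.rpow_add (by norm_num)]; congr 1; ring

/-- Test vector. -/
noncomputable def cc (L j : ℕ) : ℝ :=
  if j ≤ L then (3.73 : ℝ) ^ j * (j * (L + 1 - j)) else 0

lemma cc_nonneg (L j : ℕ) : 0 ≤ cc L j := by
  unfold cc
  split_ifs with h
  · have : (j : ℝ) ≤ L := by exact_mod_cast h
    have : (0 : ℝ) ≤ L + 1 - j := by linarith
    positivity
  · exact le_rfl

lemma cc_eq (L j : ℕ) (h : j ≤ L + 1) : cc L j = (3.73 : ℝ) ^ j * (j * (L + 1 - j)) := by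
  unfold cc
  split_ifs with h'
  · rfl
  · obtain rfl : j = L + 1 := by omega
    push_cast; ring

lemma gg_lower (N m L j : ℕ) (hL : 10000 ≤ L) (h1 : 1 ≤ j) (hj : j ≤ L)
    (hp : ∀ i, m ≤ i → i ≤ m + L → 0.93265 ≤ pp N i)
    (hq : ∀ i, m + 2 ≤ i → 0.067035 ≤ qq N i) : 0.1 ≤ gg N m (cc L) j := by
  obtain ⟨i, rfl⟩ : ∃ i, j = i + 1 := ⟨j - 1, by omega⟩
  unfold gg
  rw [if_neg (by omega), show i + 1 - 1 = i by omega]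
  have a := mul_le_mul_of_nonneg_left (hp (m + i) (by omega) (by omega)) (cc_nonneg L i)
  have b := mul_le_mul_of_nonneg_left (hq (m + (i + 1 + 1)) (by omega)) (cc_nonneg L (i + 1 + 1))
  suffices H : 0.1 ≤ cc L i * 0.93265 + cc L (i + 1 + 1) * 0.067035 - cc L (i + 1) / 2 by linarith
  rw [cc_eq L i (by omega), cc_eq L (i + 1) (by omega), cc_eq L (i + 1 + 1) (by omega)]
  have hr : (1 : ℝ) ≤ (3.73 : ℝ) ^ i := one_le_pow₀ (by norm_num)
  have hiL : (i : ℝ) + 1 ≤ L := by exact_mod_cast hj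
  have hi0 : (0 : ℝ) ≤ i := Nat.cast_nonneg _
  have hL' : (10000 : ℝ) ≤ L := by exact_mod_cast hL
  have hb : (L : ℝ) ≤ (i + 1) * (L - i) := by nlinarith
  set x := (3.73 : ℝ) ^ i
  have key : (0.1 : ℝ) ≤ i * (L + 1 - i) * 0.93265 + 3.73 ^ 2 * ((i + 2) * (L - 1 - i)) * 0.067035
      - 3.73 * ((i + 1) * (L - i)) / 2 := by
    nlinarith
  rw [pow_succ, pow_succ]
  push_cast
  calc (0.1 : ℝ) ≤ 1 * 0.1 := by norm_num
    _ ≤ x * (i * (L + 1 - i) * 0.93265 + 3.73 ^ 2 * ((i + 2) * (L - 1 - i)) * 0.067035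
      - 3.73 * ((i + 1) * (L - i)) / 2) := by gcongr
    _ = _ := by ring

end KL

theorem stmt_6 :
    ∃ n₀ : ℕ, ∀ n : ℕ, n₀ ≤ n →
      ∀ A : Finset (EuclideanSpace ℝ (Fin n)),
        (∀ u ∈ A, ‖u‖ = 1) →
        (∀ u ∈ A, ∀ v ∈ A, u ≠ v → ⟪u, v⟫ ≤ 1 / 2) →
        (A.card : ℝ) ≤ (2 : ℝ) ^ ((0.402 : ℝ) * (n : ℝ)) := by
  obtain ⟨L, hL⟩ : ∃ L : ℕ, L = 10000 := ⟨_, rfl⟩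
  set K : ℝ := (∑ j ∈ Finset.range (L + 1 + 1), KL.cc L j) ^ 2 / (2 * 0.1) with hK
  have hK0 : 0 ≤ K := by positivity
  obtain ⟨n₁, hn₁⟩ := KL.K_bound K
  refine ⟨n₁ + 10 ^ 9, fun n hn A hA hs => ?_⟩
  refine le_trans ?_ (hn₁ n (by omega))
  obtain ⟨N, rfl⟩ : ∃ N, n = N + 2 := ⟨n - 2, by omega⟩
  obtain ⟨m, hm1, hm2⟩ : ∃ m : ℕ, 155 * (m + 1) ≤ 12 * (N + 2) ∧ 12 * (N + 2) ≤ 155 * (m + 2) :=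
    ⟨12 * (N + 2) / 155 - 1, by omega, by omega⟩
  have hN : (10 ^ 8 : ℝ) ≤ N := by
    have : 10 ^ 8 ≤ N := by omega
    exact_mod_cast this
  have hp : ∀ i, m ≤ i → i ≤ m + L → 0.93265 ≤ KL.pp N i := by
    intro i h1 h2
    have h3 : 155 * (i + 1) ≤ 12 * (N + 2) + 155 * 10000 := by omega
    have h4 : 155 * ((i : ℝ) + 1) ≤ 12 * (N + 2) + 155 * 10000 := by exact_mod_cast h3
    unfold KL.pp
    rw [le_div_iff₀ (by positivity)]
    linarith
  have hq : ∀ i, m + 2 ≤ i → 0.067035 ≤ KL.qq N i := by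
    intro i h1
    have h3 : 12 * (N + 2) ≤ 155 * i := by omega
    have h4 : 12 * ((N : ℝ) + 2) ≤ 155 * i := by exact_mod_cast h3
    unfold KL.qq
    rw [le_div_iff₀ (by positivity)]
    linarith
  have hg := fun j h1 h2 => KL.gg_lower N m L j hL.ge h1 h2 hp hq
  have hc := KL.cc_nonneg L
  have hpn : ∀ i, 0 ≤ KL.pp N i := fun i => by unfold KL.pp; positivity
  have hqn : ∀ i, 0 ≤ KL.qq N i := fun i => by unfold KL.qq; positivity
  have c0 : KL.cc L 0 = 0 := by simp [KL.cc]
  have cM : KL.cc L (L + 1) = 0 := by simp [KL.cc]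
  have cM1 : KL.cc L (L + 1 + 1) = 0 := by simp [KL.cc]
  have hc1 : 1 ≤ KL.cc L 1 := by
    rw [KL.cc_eq L 1 (by omega), hL]; norm_num
  have main := KL.LP N m (L + 1) A hA hs (KL.cc L) c0 cM cM1 hc (by omega) (by
      intro j hj
      rcases Nat.eq_zero_or_pos j with rfl | hj0
      · unfold KL.gg
        rw [c0]
        have := mul_nonneg (hc 1) (hqn (m + 1))
        simpa using this
      · rcases Nat.lt_or_ge L j with h | h
        · obtain rfl : j = L + 1 := by omega
          unfold KL.gg
          rw [if_neg (by omega), cM, cM1]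
          have := mul_nonneg (hc (L + 1 - 1)) (hpn (m + (L + 1 - 1)))
          linarith
        · have := hg j hj0 h
          linarith) 0.1 (by norm_num) (by
      have := hg 1 le_rfl (by omega)
      calc (0.1 : ℝ) = 0.1 * 1 := by norm_num
        _ ≤ _ := mul_le_mul this hc1 (by norm_num) (le_trans (by norm_num) this))
  refine main.trans ?_
  rw [← hK]
  refine mul_le_mul_of_nonneg_left ?_ hK0
  have hb := KL.choose_bound (N + 2) (m + 1) (by
    have : 155 * ((m : ℝ) + 1) ≤ 12 * (N + 2) := by exact_mod_cast hm1
    push_cast; linarith)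
  refine le_trans ?_ hb
  exact_mod_cast Nat.choose_le_choose (m + 1) (by omega)
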